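/- For every θ, θ′ ∈ (0, π) with θ ≠ θ′, there exists a constant C > 0 such that for all integers L ≥ 2, |(1/(L+1)) · Σ_{ℓ=0}^{L} (2ℓ+1) · P_ℓ(cos θ) · P_ℓ(cos θ′)| ≤ C · (log L)/L. -/

import Mathlib

open Real Filter Finset

/-- The `n`-th Legendre polynomial, defined via Rodrigues' formula
`P_n(t) = (1/(2^n n!)) (d/dt)^n (t^2 - 1)^n`. -/
noncomputable def legendreP (n : ℕ) : Polynomial ℝ :=
  ((2 ^ n * n.factorial : ℝ))⁻¹ •
    ((fun q : Polynomial ℝ => Polynomial.derivative q)^[n] ((Polynomial.X ^ 2 - 1) ^ n))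

open Polynomial in
/-- Leibniz rule for iterated derivatives of `X * f`. -/
theorem iterate_derivative_X_mul_succ (k : ℕ) (f : ℝ[X]) :
    derivative^[k + 1] (X * f) =
      X * derivative^[k + 1] f + ((k : ℝ[X]) + 1) * derivative^[k] f := by
  induction k with
  | zero => simp [derivative_mul]; ring
  | succ k ih =>
    rw [Function.iterate_succ_apply', ih]
    simp only [derivative_add, derivative_mul, derivative_X, derivative_natCast, derivative_one,
      ← Function.iterate_succ_apply' (f := derivative)]
    push_cast
    ring

open Polynomial in
theorem iterate_derivative_X_mul_pred (k : ℕ) (f : ℝ[X]) :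
    derivative^[k] (X * f) = X * derivative^[k] f + (k : ℝ[X]) * derivative^[k - 1] f := by
  cases k with
  | zero => simp
  | succ k => simpa using iterate_derivative_X_mul_succ k f

open Polynomial in
theorem iterate_derivative_succ_X_sq_sub_one_pow (k n : ℕ) :
    derivative^[k + 1] ((X ^ 2 - 1 : ℝ[X]) ^ (n + 1)) =
      2 * ((n : ℝ[X]) + 1) * derivative^[k] (X * (X ^ 2 - 1) ^ n) := by
  have h : derivative ((X ^ 2 - 1 : ℝ[X]) ^ (n + 1)) =
      ((2 * (n + 1) : ℕ) : ℝ[X]) * (X * (X ^ 2 - 1) ^ n) := by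
    simp [derivative_pow, C_ofNat]
    ring
  rw [Function.iterate_succ_apply, h, iterate_derivative_natCast_mul]
  push_cast
  ring

open Polynomial in
/-- Three-term recurrence for the unnormalised polynomials of Rodrigues' formula. -/
theorem rodrigues_recurrence (n : ℕ) :
    derivative^[n + 2] ((X ^ 2 - 1 : ℝ[X]) ^ (n + 2)) =
      (4 * (n : ℝ[X]) + 6) * X * derivative^[n + 1] ((X ^ 2 - 1 : ℝ[X]) ^ (n + 1))
        - 4 * ((n : ℝ[X]) + 1) ^ 2 * derivative^[n] ((X ^ 2 - 1 : ℝ[X]) ^ n) := by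
  cases n with
  | zero =>
    simp [derivative_pow, C_ofNat]
    ring
  | succ m =>
    have hR₂ := iterate_derivative_succ_X_sq_sub_one_pow (m + 1) (m + 1)
    rw [iterate_derivative_X_mul_succ] at hR₂
    have hR₃ := iterate_derivative_succ_X_sq_sub_one_pow (m + 2) (m + 2)
    rw [iterate_derivative_X_mul_succ] at hR₃
    have hS := iterate_derivative_succ_X_sq_sub_one_pow m (m + 1)
    rw [iterate_derivative_X_mul_pred] at hS
    have hS' : derivative^[m + 1] ((X ^ 2 - 1 : ℝ[X]) ^ (m + 2)) =
        (X ^ 2 - 1) * derivative^[m + 1] ((X ^ 2 - 1 : ℝ[X]) ^ (m + 1))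
          + 2 * ((m : ℝ[X]) + 1) * X * derivative^[m] ((X ^ 2 - 1 : ℝ[X]) ^ (m + 1))
          + ((m : ℝ[X]) + 1) * (m : ℝ[X]) * derivative^[m - 1] ((X ^ 2 - 1 : ℝ[X]) ^ (m + 1)) := by
      rw [show (X ^ 2 - 1 : ℝ[X]) ^ (m + 2) =
          X * (X * (X ^ 2 - 1) ^ (m + 1)) - (X ^ 2 - 1) ^ (m + 1) by ring, iterate_derivative_sub, iterate_derivative_X_mul_succ,
        iterate_derivative_X_mul_succ, iterate_derivative_X_mul_pred]
      generalize (X ^ 2 - 1 : ℝ[X]) ^ (m + 1) = f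
      ring
    push_cast at *
    simp only [add_assoc, Nat.reduceAdd] at *
    generalize derivative^[m + 3] ((X ^ 2 - 1 : ℝ[X]) ^ (m + 3)) = R₃ at *
    generalize derivative^[m + 2] ((X ^ 2 - 1 : ℝ[X]) ^ (m + 2)) = R₂ at *
    generalize derivative^[m + 1] ((X ^ 2 - 1 : ℝ[X]) ^ (m + 1)) = R₁ at *
    generalize derivative^[m + 1] ((X ^ 2 - 1 : ℝ[X]) ^ (m + 2)) = S₂ at *
    linear_combination hR₃ + 2 * ((m : ℝ[X]) + 2) * (2 * ((m : ℝ[X]) + 2) * hS'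
      - ((m : ℝ[X]) + 1) * hS) - 2 * ((m : ℝ[X]) + 2) * X * hR₂

theorem legendreP_zero : legendreP 0 = 1 := by
  simp [legendreP]

theorem legendreP_one : legendreP 1 = Polynomial.X := by
  have h : Polynomial.C (2⁻¹ : ℝ) * (1 + 1) = 1 := by
    rw [← Polynomial.C_1, ← Polynomial.C_add, ← Polynomial.C_mul]; norm_num
  simp [legendreP, Polynomial.smul_eq_C_mul, ← mul_assoc, h]

/-- Bonnet's recurrence for the values of the Legendre polynomials. -/
theorem legendreP_eval_recurrence (n : ℕ) (x : ℝ) :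
    ((n : ℝ) + 2) * (legendreP (n + 2)).eval x =
      (2 * n + 3) * x * (legendreP (n + 1)).eval x - (n + 1) * (legendreP n).eval x := by
  have h := congrArg (Polynomial.eval x) (rodrigues_recurrence n)
  simp only [Polynomial.eval_sub, Polynomial.eval_mul, Polynomial.eval_add, Polynomial.eval_pow,
    Polynomial.eval_natCast, Polynomial.eval_ofNat, Polynomial.eval_one, Polynomial.eval_X] at h
  have hf : (n.factorial : ℝ) ≠ 0 := by positivity
  have hn : (n : ℝ) + 1 ≠ 0 := by positivity
  have hn' : (n : ℝ) + 2 ≠ 0 := by positivity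
  simp only [legendreP, Polynomial.eval_smul, smul_eq_mul]
  rw [h]
  simp only [Nat.factorial_succ]
  push_cast
  rw [show (n : ℝ) + 1 + 1 = n + 2 by ring]
  field_simp
  ring

/-- The Christoffel–Darboux identity for Legendre polynomials. -/
theorem legendreP_christoffel_darboux (x y : ℝ) (L : ℕ) :
    (x - y) * ∑ ℓ ∈ Finset.range (L + 1),
        (2 * (ℓ : ℝ) + 1) * (legendreP ℓ).eval x * (legendreP ℓ).eval y =
      (L + 1) * ((legendreP (L + 1)).eval x * (legendreP L).eval y
        - (legendreP L).eval x * (legendreP (L + 1)).eval y) := by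
  induction L with
  | zero => simp [legendreP_zero, legendreP_one]
  | succ L ih =>
    rw [Finset.sum_range_succ, mul_add, ih]
    push_cast
    linear_combination (legendreP (L + 1)).eval x * legendreP_eval_recurrence L y
      - (legendreP (L + 1)).eval y * legendreP_eval_recurrence L x

/-- A discrete energy of the recurrence: this quantity is nonincreasing in `n`. -/
theorem legendreP_energy_le (x : ℝ) (n : ℕ) :
    ((n : ℝ) + 1) ^ 2 / (2 * n + 1) * (legendreP (n + 1)).eval x ^ 2
      + ((n : ℝ) + 1) ^ 2 / (2 * n + 3) * (legendreP n).eval x ^ 2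
      - x * (n + 1) * (legendreP (n + 1)).eval x * (legendreP n).eval x ≤ 1 / 3 := by
  induction n with
  | zero =>
    simp [legendreP_zero, legendreP_one]
    nlinarith
  | succ n ih =>
    refine le_trans ?_ ih
    have hrec := legendreP_eval_recurrence n x
    have hc : (0 : ℝ) ≤ 1 / ((2 * n + 1) * (2 * n + 5)) := by positivity
    have hE := mul_nonneg hc (sq_nonneg ((legendreP (n + 1)).eval x))
    generalize (legendreP (n + 2)).eval x = r at *
    generalize (legendreP (n + 1)).eval x = q at *
    generalize (legendreP n).eval x = p at *
    have hn' : (n : ℝ) + 2 ≠ 0 := by positivity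
    have hr : r = ((2 * n + 3) * x * q - (n + 1) * p) / (n + 2) := by
      rw [eq_div_iff hn']; linarith
    push_cast
    have key : ((n : ℝ) + 1 + 1) ^ 2 / (2 * (n + 1) + 1) * r ^ 2
        + ((n : ℝ) + 1 + 1) ^ 2 / (2 * (n + 1) + 3) * q ^ 2 - x * (n + 1 + 1) * r * q
        = ((n : ℝ) + 1) ^ 2 / (2 * n + 1) * q ^ 2
      + ((n : ℝ) + 1) ^ 2 / (2 * n + 3) * p ^ 2
      - x * (n + 1) * q * p - 1 / ((2 * n + 1) * (2 * n + 5)) * q ^ 2 := by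
      have h1 : 2 * ((n : ℝ) + 1) + 1 ≠ 0 := by positivity
      have h2 : 2 * ((n : ℝ) + 1) + 3 ≠ 0 := by positivity
      have h3 : 2 * (n : ℝ) + 1 ≠ 0 := by positivity
      have h4 : 2 * (n : ℝ) + 3 ≠ 0 := by positivity
      have h5 : 2 * (n : ℝ) + 5 ≠ 0 := by positivity
      rw [hr, show (n : ℝ) + 1 + 1 = n + 2 by ring, show 2 * ((n : ℝ) + 1) + 1 = 2 * n + 3 by ring,
        show 2 * ((n : ℝ) + 1) + 3 = 2 * n + 5 by ring]
      field_simp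
      ring
    linarith

theorem mul_legendreP_eval_sq_le (x : ℝ) (hx : |x| < 1) (n : ℕ) :
    (n : ℝ) * (legendreP n).eval x ^ 2 ≤ 1 / (1 - |x|) := by
  have hx' : 0 < 1 - |x| := by linarith
  cases n with
  | zero => simpa using hx'.le
  | succ n =>
    have hE := legendreP_energy_le x n
    push_cast
    generalize (legendreP (n + 1)).eval x = q at *
    generalize (legendreP n).eval x = p at *
    set A := ((n : ℝ) + 1) ^ 2 / (2 * n + 1) with hA
    set B := ((n : ℝ) + 1) ^ 2 / (2 * n + 3) with hB
    have hA2 : ((n : ℝ) + 1) / 2 ≤ A := by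
      rw [hA, div_le_div_iff₀ (by positivity) (by positivity)]
      nlinarith [(Nat.cast_nonneg n : (0 : ℝ) ≤ n)]
    have hB0 : 0 ≤ B := by positivity
    have hAB : ((n : ℝ) + 1) ^ 2 ≤ 4 * A * B := by
      have : 4 * A * B = 4 * ((n : ℝ) + 1) ^ 4 / ((2 * n + 1) * (2 * n + 3)) := by
        rw [hA, hB]; field_simp
      rw [this, le_div_iff₀ (by positivity)]
      nlinarith [sq_nonneg ((n : ℝ) + 1)]
    have hcross : ((n : ℝ) + 1) * |q * p| ≤ A * q ^ 2 + B * p ^ 2 := by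
      rw [← pow_le_pow_iff_left₀ (by positivity) (by positivity) two_ne_zero, mul_pow, sq_abs]
      nlinarith [sq_nonneg (A * q ^ 2 - B * p ^ 2),
        mul_le_mul_of_nonneg_right hAB (sq_nonneg (q * p))]
    have hxqp : x * (n + 1) * q * p ≤ |x| * (((n : ℝ) + 1) * |q * p|) := by
      calc x * (n + 1) * q * p ≤ |x * (n + 1) * q * p| := le_abs_self _
        _ = _ := by
          rw [show x * (n + 1) * q * p = x * ((n + 1) * (q * p)) by ring, abs_mul, abs_mul,
            abs_of_nonneg (by positivity : (0 : ℝ) ≤ n + 1)]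
    rw [le_div_iff₀ hx']
    have h1 := mul_le_mul_of_nonneg_left hcross (abs_nonneg x)
    have h2 : (1 - |x|) * (A * q ^ 2) ≤ 1 / 3 := by
      have := mul_nonneg hx'.le (mul_nonneg hB0 (sq_nonneg p))
      linarith
    have h3 := mul_le_mul_of_nonneg_left
      (mul_le_mul_of_nonneg_right hA2 (sq_nonneg q)) hx'.le
    linarith

theorem abs_mul_sub_mul_le_of_sq_le {a b c d K : ℝ} (ha : a ^ 2 ≤ K) (hb : b ^ 2 ≤ K)
    (hc : c ^ 2 ≤ K) (hd : d ^ 2 ≤ K) : |a * b - c * d| ≤ 2 * K := by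
  rw [abs_le]
  constructor <;>
    nlinarith [sq_nonneg (a - b), sq_nonneg (a + b), sq_nonneg (c - d), sq_nonneg (c + d)]

/-- For  in , the Cesàro average of 
is . -/
theorem cesaro_mixed_legendre (θ θ' : ℝ) (hθ : θ ∈ Set.Ioo 0 π)
    (hθ' : θ' ∈ Set.Ioo 0 π) (hne : θ ≠ θ') :
    ∃ C > 0, ∀ L : ℕ, 2 ≤ L →
      |(1 / (L + 1 : ℝ)) * ∑ ℓ ∈ Finset.range (L + 1),
        (2 * (ℓ : ℝ) + 1) * (legendreP ℓ).eval (Real.cos θ) * (legendreP ℓ).eval (Real.cos θ')|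
        ≤ C * Real.log L / L := by
  have abs_cos_lt {t : ℝ} (ht : t ∈ Set.Ioo 0 π) : |Real.cos t| < 1 := by
    rw [← sq_lt_one_iff_abs_lt_one]
    nlinarith [Real.sin_sq_add_cos_sq t, pow_pos (Real.sin_pos_of_mem_Ioo ht) 2]
  have hxy : Real.cos θ - Real.cos θ' ≠ 0 := sub_ne_zero.2 fun h =>
    hne (Real.injOn_cos (Set.Ioo_subset_Icc_self hθ) (Set.Ioo_subset_Icc_self hθ') h)
  have hx := abs_cos_lt hθ
  have hy := abs_cos_lt hθ'
  generalize Real.cos θ = x at *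
  generalize Real.cos θ' = y at *
  set M : ℝ := 1 / (1 - |x|) + 1 / (1 - |y|) with hM
  have hx0 : 0 < 1 / (1 - |x|) := one_div_pos.2 (by linarith)
  have hy0 : 0 < 1 / (1 - |y|) := one_div_pos.2 (by linarith)
  have hM0 : 0 < M := add_pos hx0 hy0
  have hlog2 : 0 < Real.log 2 := Real.log_pos one_lt_two
  have hd : 0 < |x - y| := abs_pos.2 hxy
  refine ⟨2 * M / (|x - y| * Real.log 2), by positivity, fun L hL => ?_⟩
  have hL0 : (0 : ℝ) < L := by exact_mod_cast (by omega : 0 < L)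
  have hbound {t : ℝ} (ht : |t| < 1) (htM : 1 / (1 - |t|) ≤ M) {n : ℕ} (hn : L ≤ n) :
      (legendreP n).eval t ^ 2 ≤ M / L := by
    rw [le_div_iff₀ hL0, mul_comm]
    have hLn : (L : ℝ) ≤ n := by exact_mod_cast hn
    exact (mul_le_mul_of_nonneg_right hLn (sq_nonneg _)).trans
      ((mul_legendreP_eval_sq_le t ht n).trans htM)
  have hxM : 1 / (1 - |x|) ≤ M := by linarith
  have hyM : 1 / (1 - |y|) ≤ M := by linarith
  have hCD := legendreP_christoffel_darboux x y L
  have hdiff := abs_mul_sub_mul_le_of_sq_le (hbound hx hxM L.le_succ) (hbound hy hyM le_rfl)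
    (hbound hx hxM le_rfl) (hbound hy hyM L.le_succ)
  have hsum : (1 / (L + 1 : ℝ)) * ∑ ℓ ∈ Finset.range (L + 1),
      (2 * (ℓ : ℝ) + 1) * (legendreP ℓ).eval x * (legendreP ℓ).eval y =
      ((legendreP (L + 1)).eval x * (legendreP L).eval y
        - (legendreP L).eval x * (legendreP (L + 1)).eval y) / (x - y) := by
    rw [eq_div_iff hxy, one_div, mul_assoc, inv_mul_eq_iff_eq_mul₀ (by positivity), ← hCD]
    ring
  have hlog : Real.log 2 ≤ Real.log L := Real.log_le_log two_pos (by exact_mod_cast hL)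
  rw [hsum, abs_div, div_le_iff₀ hd]
  calc _ ≤ 2 * (M / L) := hdiff
    _ = 2 * M / (|x - y| * Real.log 2) * Real.log 2 / L * |x - y| := by field_simp
    _ ≤ _ := by gcongr
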